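/- arXiv:1802.00418 — 8 statements merged into one kernel-verified Lean document; each statement's English description precedes it below -/
import Mathlib

section
/- Let r₀ > 0, a > 0 and γ ∈ (0, 1]. Suppose ẽ : (0, r₀] → ℝ is differentiable, ẽ(r) > 0 for every r ∈ (0, r₀], and ẽ'(r) ≥ (a / r) · ẽ(r)^(1+γ) for every r ∈ (0, r₀]. Then for every r ∈ (0, r₀] one has ẽ(r) ≤ ( ẽ(r₀)^(−γ) + a·γ·log(r₀ / r) )^(−1/γ). -/
/-- Gronwall-type lemma, Step 1 of uniqueness of tangent cones.
If `ẽ > 0` on `(0, r₀]` satisfies `ẽ'(r) ≥ (a/r) ẽ(r)^(1+γ)`, then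
`ẽ(r) ≤ (ẽ(r₀)^(-γ) + aγ log(r₀/r))^(-1/γ)`. -/
theorem log_decay_of_diff_ineq (r₀ a γ : ℝ) (hr₀ : 0 < r₀) (ha : 0 < a)
    (hγ : γ ∈ Set.Ioc (0 : ℝ) 1) (e e' : ℝ → ℝ)
    (hderiv : ∀ r ∈ Set.Ioc (0 : ℝ) r₀, HasDerivAt e (e' r) r)
    (hpos : ∀ r ∈ Set.Ioc (0 : ℝ) r₀, 0 < e r)
    (hineq : ∀ r ∈ Set.Ioc (0 : ℝ) r₀, e' r ≥ (a / r) * e r ^ (1 + γ)) :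
    ∀ r ∈ Set.Ioc (0 : ℝ) r₀,
      e r ≤ (e r₀ ^ (-γ) + a * γ * Real.log (r₀ / r)) ^ (-1 / γ) := by
  obtain ⟨hγ0, hγ1⟩ := hγ
  have hd : ∀ x ∈ Set.Ioc (0 : ℝ) r₀,
      HasDerivAt (fun r => -(e r ^ (-γ)) - a * γ * Real.log r)
        (-(e' x * (-γ) * e x ^ (-γ - 1)) - a * γ * x⁻¹) x := by
    intro x hx
    exact ((hderiv x hx).rpow_const (Or.inl (hpos x hx).ne')).neg.sub
      ((Real.hasDerivAt_log hx.1.ne').const_mul (a * γ))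
  have hmono : MonotoneOn (fun r => -(e r ^ (-γ)) - a * γ * Real.log r) (Set.Ioc 0 r₀) := by
    refine monotoneOn_of_hasDerivWithinAt_nonneg (convex_Ioc 0 r₀)
      (fun x hx => (hd x hx).continuousAt.continuousWithinAt)
      (fun x hx => (hd x (interior_subset hx)).hasDerivWithinAt) ?_
    intro x hx
    have hx' := interior_subset hx
    have hp := hpos x hx'
    have h1 : e x ^ (1 + γ) * e x ^ (-γ - 1) = 1 := by
      rw [← Real.rpow_add hp]
      have : 1 + γ + (-γ - 1) = 0 := by ring
      rw [this, Real.rpow_zero]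
    have h2 := mul_le_mul_of_nonneg_right (hineq x hx') (Real.rpow_nonneg hp.le (-γ - 1))
    rw [mul_assoc, h1, mul_one, div_eq_mul_inv] at h2
    have h3 := mul_le_mul_of_nonneg_left h2 hγ0.le
    linarith
  intro r hr
  have h := hmono hr ⟨hr₀, le_rfl⟩ hr.2
  simp only at h
  have hlog : Real.log (r₀ / r) = Real.log r₀ - Real.log r :=
    Real.log_div hr₀.ne' hr.1.ne'
  have hB : e r₀ ^ (-γ) + a * γ * Real.log (r₀ / r) ≤ e r ^ (-γ) := by
    rw [hlog]; linarith
  have hlog0 : 0 ≤ Real.log (r₀ / r) := Real.log_nonneg ((one_le_div hr.1).2 hr.2)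
  have hBpos : 0 < e r₀ ^ (-γ) + a * γ * Real.log (r₀ / r) := by
    have := Real.rpow_pos_of_pos (hpos r₀ ⟨hr₀, le_rfl⟩) (-γ)
    positivity
  have hexp : -1 / γ ≤ 0 := div_nonpos_of_nonpos_of_nonneg (by norm_num) hγ0.le
  have hfin := Real.rpow_le_rpow_of_nonpos hBpos hB hexp
  rw [← Real.rpow_mul (hpos r hr).le] at hfin
  have : -γ * (-1 / γ) = 1 := by field_simp
  rwa [this, Real.rpow_one] at hfin
end

section
/- Let r₀ > 0, a > 0, C > 0, α > 0 and γ ∈ (0, 1). Suppose e : (0, r₀] → ℝ is differentiable, e(r) ≥ 0 for every r ∈ (0, r₀], and e'(r) ≥ (a / r) · e(r)^(1+γ) − C · r^(α−1) for every r ∈ (0, r₀]. Then there exist r₁ ∈ (0, r₀] and a constant C₁ > 0 such that e(r) ≤ C₁ · ( log(r₁ / r) )^(−1/γ) for every r ∈ (0, r₁). -/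
/-- decay estimate of Step 1 with power-type error.
If `e ≥ 0` on `(0, r₀]` satisfies `e'(r) ≥ (a/r) e(r)^(1+γ) − C r^(α−1)`, then for some
`r₁ ∈ (0, r₀]` and `C₁ > 0` one has `e(r) ≤ C₁ (log(r₁/r))^(−1/γ)` for `r ∈ (0, r₁)`. -/
theorem log_decay_of_diff_ineq_with_error (r₀ a C α γ : ℝ) (hr₀ : 0 < r₀) (ha : 0 < a)
    (hC : 0 < C) (hα : 0 < α) (hγ : γ ∈ Set.Ioo (0 : ℝ) 1) (e e' : ℝ → ℝ)
    (hderiv : ∀ r ∈ Set.Ioc (0 : ℝ) r₀, HasDerivAt e (e' r) r)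
    (hnonneg : ∀ r ∈ Set.Ioc (0 : ℝ) r₀, 0 ≤ e r)
    (hineq : ∀ r ∈ Set.Ioc (0 : ℝ) r₀, e' r ≥ (a / r) * e r ^ (1 + γ) - C * r ^ (α - 1)) :
    ∃ r₁ ∈ Set.Ioc (0 : ℝ) r₀, ∃ C₁ : ℝ, 0 < C₁ ∧
      ∀ r ∈ Set.Ioo (0 : ℝ) r₁, e r ≤ C₁ * Real.log (r₁ / r) ^ (-1 / γ) := by
  obtain ⟨hγ0, hγ1⟩ := hγ
  set K : ℝ := 2 * C / α with hK
  have hKpos : 0 < K := by positivity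
  set p : ℝ := 1 + γ with hp
  have hp0 : 0 < p := by linarith
  set b : ℝ := min a (C / K ^ p) / 2 ^ p with hb
  have hKp : 0 < K ^ p := Real.rpow_pos_of_pos hKpos p
  have h2p : (0 : ℝ) < 2 ^ p := Real.rpow_pos_of_pos two_pos p
  have hbpos : 0 < b := div_pos (lt_min ha (div_pos hC hKp)) h2p
  have hb1 : b * 2 ^ p ≤ a := by
    rw [hb, div_mul_cancel₀ _ h2p.ne']; exact min_le_left _ _
  have hb2 : b * 2 ^ p * K ^ p ≤ C := by
    rw [hb, div_mul_cancel₀ _ h2p.ne', ← le_div_iff₀ hKp]; exact min_le_right _ _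
  set r₁ : ℝ := min r₀ 1 with hr₁
  have hr₁pos : 0 < r₁ := lt_min hr₀ one_pos
  have hsub : ∀ r ∈ Set.Ioc (0 : ℝ) r₁, r ∈ Set.Ioc (0 : ℝ) r₀ := fun r hr =>
    ⟨hr.1, hr.2.trans (min_le_left _ _)⟩
  let f : ℝ → ℝ := fun r => e r + K * r ^ α
  have hfpos : ∀ r ∈ Set.Ioc (0 : ℝ) r₁, 0 < f r := fun r hr =>
    add_pos_of_nonneg_of_pos (hnonneg r (hsub r hr))
      (mul_pos hKpos (Real.rpow_pos_of_pos hr.1 α))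
  have hfd : ∀ r ∈ Set.Ioc (0 : ℝ) r₁,
      HasDerivAt f (e' r + K * (α * r ^ (α - 1))) r := fun r hr =>
    (hderiv r (hsub r hr)).add
      ((Real.hasDerivAt_rpow_const (Or.inl hr.1.ne')).const_mul K)
  have hfp : ∀ r ∈ Set.Ioc (0 : ℝ) r₁,
      b / r * f r ^ p ≤ e' r + K * (α * r ^ (α - 1)) := by
    intro r hr
    have hr0 := hr.1
    have hr1 : r ≤ 1 := hr.2.trans (min_le_right _ _)
    have he := hnonneg r (hsub r hr)
    have hrα : 0 < r ^ α := Real.rpow_pos_of_pos hr0 α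
    have hep : 0 ≤ e r ^ p := Real.rpow_nonneg he p
    have hrp : (r ^ α) ^ p ≤ r ^ α := by
      have h1 : r ^ α ≤ 1 := Real.rpow_le_one hr0.le hr1 hα.le
      calc (r ^ α) ^ p ≤ (r ^ α) ^ (1 : ℝ) :=
            Real.rpow_le_rpow_of_exponent_ge hrα h1 (by linarith)
        _ = r ^ α := Real.rpow_one _
    have hq : (K * r ^ α) ^ p = K ^ p * (r ^ α) ^ p := Real.mul_rpow hKpos.le hrα.le
    have hqn : 0 ≤ (K * r ^ α) ^ p := Real.rpow_nonneg (by positivity) p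
    have key : f r ^ p ≤ 2 ^ p * (e r ^ p + (K * r ^ α) ^ p) := by
      have hKr : 0 ≤ K * r ^ α := by positivity
      rcases le_total (e r) (K * r ^ α) with h | h
      · calc f r ^ p ≤ (2 * (K * r ^ α)) ^ p :=
              Real.rpow_le_rpow (hfpos r hr).le (by simp only [f]; linarith) hp0.le
          _ = 2 ^ p * (K * r ^ α) ^ p := Real.mul_rpow two_pos.le hKr
          _ ≤ _ := mul_le_mul_of_nonneg_left (by linarith) h2p.le
      · calc f r ^ p ≤ (2 * e r) ^ p :=
              Real.rpow_le_rpow (hfpos r hr).le (by simp only [f]; linarith) hp0.le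
          _ = 2 ^ p * e r ^ p := Real.mul_rpow two_pos.le he
          _ ≤ _ := mul_le_mul_of_nonneg_left (by linarith) h2p.le
    have hmain : b * f r ^ p ≤ a * e r ^ p + C * r ^ α := by
      calc b * f r ^ p ≤ b * (2 ^ p * (e r ^ p + (K * r ^ α) ^ p)) :=
            mul_le_mul_of_nonneg_left key hbpos.le
        _ = (b * 2 ^ p) * e r ^ p + (b * 2 ^ p * K ^ p) * (r ^ α) ^ p := by rw [hq]; ring
        _ ≤ a * e r ^ p + C * r ^ α :=
            add_le_add (mul_le_mul_of_nonneg_right hb1 hep)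
              (mul_le_mul hb2 hrp (Real.rpow_nonneg hrα.le p) hC.le)
    have hKα : K * α = 2 * C := by rw [hK]; field_simp
    have hsubr : r ^ (α - 1) = r ^ α / r := by
      rw [Real.rpow_sub hr0, Real.rpow_one]
    have h3 := hineq r (hsub r hr)
    have h4 : b / r * f r ^ p ≤ a / r * e r ^ p + C * r ^ (α - 1) := by
      rw [hsubr]
      calc b / r * f r ^ p = (b * f r ^ p) / r := by ring
        _ ≤ (a * e r ^ p + C * r ^ α) / r := div_le_div_of_nonneg_right hmain hr0.le
        _ = _ := by ring
    have h5 : K * (α * r ^ (α - 1)) = 2 * C * r ^ (α - 1) := by rw [← mul_assoc, hKα]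
    rw [h5]
    linarith
  let g : ℝ → ℝ := fun r => f r ^ (-γ) + γ * b * Real.log r
  have hgd : ∀ r ∈ Set.Ioc (0 : ℝ) r₁, HasDerivAt g
      ((e' r + K * (α * r ^ (α - 1))) * (-γ) * f r ^ (-γ - 1) + γ * b * r⁻¹) r := fun r hr =>
    ((hfd r hr).rpow_const (Or.inl (hfpos r hr).ne')).add
      ((Real.hasDerivAt_log hr.1.ne').const_mul (γ * b))
  have hanti : AntitoneOn g (Set.Ioc 0 r₁) := by
    apply antitoneOn_of_deriv_nonpos (convex_Ioc 0 r₁)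
    · exact fun r hr => (hgd r hr).continuousAt.continuousWithinAt
    · exact fun r hr => (hgd r (interior_subset hr)).differentiableAt.differentiableWithinAt
    · intro r hr
      have hr' := interior_subset hr
      rw [(hgd r hr').deriv]
      have hf := hfpos r hr'
      have hn : 0 < f r ^ (-γ - 1) := Real.rpow_pos_of_pos hf _
      have hone : f r ^ p * f r ^ (-γ - 1) = 1 := by
        rw [← Real.rpow_add hf, hp, show 1 + γ + (-γ - 1) = 0 by ring, Real.rpow_zero]
      have h6 := mul_le_mul_of_nonneg_right (hfp r hr') hn.le
      rw [mul_assoc, hone, mul_one, div_eq_mul_inv] at h6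
      have h7 := mul_le_mul_of_nonneg_left h6 hγ0.le
      linarith
  refine ⟨r₁, ⟨hr₁pos, min_le_left _ _⟩, (γ * b) ^ (-1 / γ),
    Real.rpow_pos_of_pos (mul_pos hγ0 hbpos) _, ?_⟩
  intro r hr
  have hr' : r ∈ Set.Ioc (0 : ℝ) r₁ := ⟨hr.1, hr.2.le⟩
  have hm : r₁ ∈ Set.Ioc (0 : ℝ) r₁ := ⟨hr₁pos, le_rfl⟩
  have hL : 0 < Real.log (r₁ / r) := Real.log_pos ((one_lt_div hr.1).2 hr.2)
  have hg := hanti hr' hm hr.2.le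
  simp only [g] at hg
  have hf1 : 0 < f r₁ ^ (-γ) := Real.rpow_pos_of_pos (hfpos r₁ hm) _
  have hle : γ * b * Real.log (r₁ / r) ≤ f r ^ (-γ) := by
    rw [Real.log_div hr₁pos.ne' hr.1.ne', mul_sub]; linarith
  have hpos : 0 < γ * b * Real.log (r₁ / r) := by positivity
  have h8 : (f r ^ (-γ)) ^ (-1 / γ) ≤ (γ * b * Real.log (r₁ / r)) ^ (-1 / γ) :=
    Real.rpow_le_rpow_of_nonpos hpos hle (div_nonpos_of_nonpos_of_nonneg (by norm_num) hγ0.le)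
  rw [← Real.rpow_mul (hfpos r hr').le, show -γ * (-1 / γ) = 1 by field_simp, Real.rpow_one,
    Real.mul_rpow (mul_pos hγ0 hbpos).le hL.le] at h8
  refine le_trans ?_ h8
  simp only [f]
  have := mul_pos hKpos (Real.rpow_pos_of_pos hr.1 α)
  linarith
end

section
/- Let r₀ > 0, a > α > 0 and C ≥ 0. Suppose e : (0, r₀] → ℝ is differentiable and e'(r) ≥ (a / r) · e(r) − C · r^(α−1) for every r ∈ (0, r₀]. Then for every r ∈ (0, r₀] one has e(r) ≤ e(r₀) · (r / r₀)^a + ( C / (a − α) ) · r^α. -/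
/-- classical epiperimetric decay, `γ = 0` / integrable case.
If `e'(r) ≥ (a/r) e(r) − C r^(α−1)` on `(0, r₀]` with `a > α > 0`, then
`e(r) ≤ e(r₀) (r/r₀)^a + (C/(a−α)) r^α`. -/
theorem power_decay_of_diff_ineq (r₀ a C α : ℝ) (hr₀ : 0 < r₀) (hα : 0 < α) (haα : α < a)
    (hC : 0 ≤ C) (e e' : ℝ → ℝ)
    (hderiv : ∀ r ∈ Set.Ioc (0 : ℝ) r₀, HasDerivAt e (e' r) r)
    (hineq : ∀ r ∈ Set.Ioc (0 : ℝ) r₀, e' r ≥ (a / r) * e r - C * r ^ (α - 1)) :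
    ∀ r ∈ Set.Ioc (0 : ℝ) r₀,
      e r ≤ e r₀ * (r / r₀) ^ a + (C / (a - α)) * r ^ α := by
  have hd : ∀ x ∈ Set.Ioc (0 : ℝ) r₀,
      HasDerivAt (fun x => e x * x ^ (-a) - C / (a - α) * x ^ (α - a))
        (x ^ (-a) * (e' x - ((a / x) * e x - C * x ^ (α - 1)))) x := by
    intro x hx
    have hx0 : 0 < x := hx.1
    have h1 := (hderiv x hx).mul (Real.hasDerivAt_rpow_const (p := -a) (Or.inl hx0.ne'))
    have h2 := (Real.hasDerivAt_rpow_const (x := x) (p := α - a) (Or.inl hx0.ne')).const_mul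
      (C / (a - α))
    refine (h1.sub h2).congr_deriv ?_
    have e1 : x ^ (-a - 1) = x ^ (-a) / x := Real.rpow_sub_one hx0.ne' _
    have e2 : x ^ (α - a - 1) = x ^ (-a) * x ^ (α - 1) := by
      rw [← Real.rpow_add hx0]; congr 1; ring
    rw [e1, e2]
    have : a - α ≠ 0 := by linarith
    field_simp
    ring
  have hmono : MonotoneOn (fun x => e x * x ^ (-a) - C / (a - α) * x ^ (α - a))
      (Set.Ioc (0 : ℝ) r₀) := by
    apply monotoneOn_of_deriv_nonneg (convex_Ioc 0 r₀)
    · exact fun x hx => (hd x hx).continuousAt.continuousWithinAt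
    · exact fun x hx => (hd x (interior_subset hx)).differentiableAt.differentiableWithinAt
    · intro x hx
      have hx := interior_subset hx
      rw [(hd x hx).deriv]
      have := hineq x hx
      exact mul_nonneg (Real.rpow_nonneg hx.1.le _) (by linarith)
  intro r hr
  have hr0 : 0 < r := hr.1
  have h := hmono hr ⟨hr₀, le_rfl⟩ hr.2
  simp only at h
  have hpos : 0 ≤ C / (a - α) * r₀ ^ (α - a) :=
    mul_nonneg (div_nonneg hC (by linarith)) (Real.rpow_nonneg hr₀.le _)
  have h' : e r * r ^ (-a) ≤ e r₀ * r₀ ^ (-a) + C / (a - α) * r ^ (α - a) := by linarith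
  have h3 := mul_le_mul_of_nonneg_right h' (Real.rpow_nonneg hr0.le a)
  have e3 : r ^ (-a) * r ^ a = 1 := by
    rw [← Real.rpow_add hr0]; simp
  have e4 : r ^ (α - a) * r ^ a = r ^ α := by
    rw [← Real.rpow_add hr0]; simp
  have e5 : (r / r₀) ^ a = r₀ ^ (-a) * r ^ a := by
    rw [Real.div_rpow hr0.le hr₀.le, Real.rpow_neg hr₀.le]; ring
  calc e r = e r * r ^ (-a) * r ^ a := by rw [mul_assoc, e3, mul_one]
    _ ≤ _ := h3
    _ = _ := by rw [e5, ← e4]; ring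
end

section
/- Let n ≥ 1 be an integer, ε ∈ (0, 1), γ ∈ (0, 1], C ≥ 0, α > 0 and r₀ > 0. Let f : (0, r₀] → ℝ be differentiable and set e(r) := f(r) / rⁿ. Assume that for every r ∈ (0, r₀] one has f(r) ≥ 0, ε · e(r)^γ ≤ 1/2, and f(r) ≤ (1 − ε · e(r)^γ) · (r / n) · f'(r) + C · r^(n+α). Then e is differentiable on (0, r₀] and e'(r) ≥ (n·ε / r) · e(r)^(1+γ) − 2·n·C · r^(α−1) for every r ∈ (0, r₀]. -/
/-- from the (log-)epiperimetric inequality to a differential inequality.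
If `f ≥ 0` satisfies `f(r) ≤ (1 − ε e(r)^γ) (r/n) f'(r) + C r^(n+α)` with `e(r) = f(r)/rⁿ`
and `ε e(r)^γ ≤ 1/2`, then `e` is differentiable on `(0, r₀]` with
`e'(r) ≥ (nε/r) e(r)^(1+γ) − 2nC r^(α−1)`. -/
theorem diff_ineq_of_epiperimetric (n : ℕ) (hn : 1 ≤ n) (ε γ C α r₀ : ℝ)
    (hε : ε ∈ Set.Ioo (0 : ℝ) 1) (hγ : γ ∈ Set.Ioc (0 : ℝ) 1) (hC : 0 ≤ C) (hα : 0 < α)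
    (hr₀ : 0 < r₀) (f f' : ℝ → ℝ)
    (hderiv : ∀ r ∈ Set.Ioc (0 : ℝ) r₀, HasDerivAt f (f' r) r)
    (e : ℝ → ℝ) (he : ∀ r, e r = f r / r ^ n)
    (hf : ∀ r ∈ Set.Ioc (0 : ℝ) r₀, 0 ≤ f r)
    (hsmall : ∀ r ∈ Set.Ioc (0 : ℝ) r₀, ε * e r ^ γ ≤ 1 / 2)
    (hepi : ∀ r ∈ Set.Ioc (0 : ℝ) r₀,
      f r ≤ (1 - ε * e r ^ γ) * (r / n) * f' r + C * r ^ ((n : ℝ) + α)) :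
    ∀ r ∈ Set.Ioc (0 : ℝ) r₀, ∃ d : ℝ, HasDerivAt e d r ∧
      d ≥ (n * ε / r) * e r ^ (1 + γ) - 2 * n * C * r ^ (α - 1) := by
  intro r hr
  have hr0 : 0 < r := hr.1
  have hP : 0 < r ^ n := pow_pos hr0 n
  have hn0 : (0 : ℝ) < n := by exact_mod_cast hn
  have hee : e = fun r => f r / r ^ n := funext he
  have hE : 0 ≤ e r := by rw [he]; exact div_nonneg (hf r hr) hP.le
  have hfE : f r = e r * r ^ n := by rw [he]; field_simp
  have hd : HasDerivAt e ((f' r * r ^ n - f r * (n * r ^ (n - 1))) / (r ^ n) ^ 2) r := by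
    have h := (hderiv r hr).fun_div (hasDerivAt_pow n r) hP.ne'
    rw [hee]
    exact h
  refine ⟨_, hd, ?_⟩
  have hpow : r ^ (n - 1) = r ^ n / r := by
    obtain ⟨m, rfl⟩ : ∃ m, n = m + 1 := ⟨n - 1, by omega⟩
    rw [Nat.add_sub_cancel, pow_succ]
    field_simp
  have h1 := hepi r hr
  have h2 := hsmall r hr
  rw [Real.rpow_add hr0, Real.rpow_natCast] at h1
  rw [Real.rpow_add_of_nonneg hE zero_le_one hγ.1.le, Real.rpow_one, Real.rpow_sub_one hr0.ne',
    hpow, hfE]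
  rw [hfE] at h1
  have hx : 0 ≤ ε * e r ^ γ := mul_nonneg hε.1.le (Real.rpow_nonneg hE γ)
  have hK : 0 ≤ C * r ^ α := mul_nonneg hC (Real.rpow_nonneg hr0.le α)
  obtain ⟨G, hG⟩ : ∃ G, G = r / n * f' r / r ^ n := ⟨_, rfl⟩
  have hf' : f' r = n / r * G * r ^ n := by rw [hG]; field_simp
  rw [hf'] at h1 ⊢
  generalize e r ^ γ = y at *
  generalize r ^ α = z at *
  generalize e r = E at *
  generalize r ^ n = P at *
  have h3 : E ≤ (1 - ε * y) * G + C * z := by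
    have h4 : (1 - ε * y) * (r / n) * (n / r * G * P) + C * (P * z)
        = ((1 - ε * y) * G + C * z) * P := by field_simp
    rw [h4] at h1
    exact le_of_mul_le_mul_right h1 hP
  have h5 : 0 ≤ G - E - (ε * y * E - 2 * (C * z)) := by
    have h6 : 0 ≤ (1 - ε * y) * (G - E - (ε * y * E - 2 * (C * z))) := by
      nlinarith [mul_nonneg hE (sq_nonneg (ε * y)), mul_nonneg hK (sub_nonneg.2 h2)]
    exact nonneg_of_mul_nonneg_right h6 (by linarith)
  have h7 : (n / r * G * P * P - E * P * (n * (P / r))) / P ^ 2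
      - (n * ε / r * (E * y) - 2 * n * C * (z / r))
      = n / r * (G - E - (ε * y * E - 2 * (C * z))) := by
    field_simp
  have h8 : 0 ≤ n / r * (G - E - (ε * y * E - 2 * (C * z))) :=
    mul_nonneg (div_pos hn0 hr0).le h5
  linarith
end

section
/- Let ℓ ≥ 1, let A : ℝ^ℓ → ℝ be continuously differentiable, let t > 0, γ ∈ (0, 1) and C₀ > 0, and let μ : [0, t] → ℝ^ℓ be differentiable with ∇A(μ(s)) ≠ 0 and μ'(s) = −∇A(μ(s)) / ‖∇A(μ(s))‖ for every s ∈ [0, t]. Assume the Łojasiewicz inequality |A(μ(s))|^(1−γ) ≤ C₀ · ‖∇A(μ(s))‖ holds for every s ∈ [0, t], and that A(μ(s)) ≥ (1/2) · A(μ(0)) > 0 for every s ∈ [0, t]. Then A(μ(t)) − A(μ(0)) ≤ −2^(γ−1) · C₀^(−1) · t · A(μ(0))^(1−γ). -/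
/-- quantitative energy decrease along the flow via Łojasiewicz.
If `μ` solves the unit-speed negative gradient flow of `A` on `[0, t]`, the Łojasiewicz
inequality `|A(μ(s))|^(1−γ) ≤ C₀ ‖∇A(μ(s))‖` holds, and `A(μ(s)) ≥ A(μ(0))/2 > 0`, then
`A(μ(t)) − A(μ(0)) ≤ −2^(γ−1) C₀⁻¹ t A(μ(0))^(1−γ)`. -/
theorem gradient_flow_energy_decrease (ℓ : ℕ) (hℓ : 1 ≤ ℓ)
    (A : EuclideanSpace ℝ (Fin ℓ) → ℝ) (hA : ContDiff ℝ 1 A) (t γ C₀ : ℝ) (ht : 0 < t)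
    (hγ : γ ∈ Set.Ioo (0 : ℝ) 1) (hC₀ : 0 < C₀)
    (μ : ℝ → EuclideanSpace ℝ (Fin ℓ))
    (hgrad : ∀ s ∈ Set.Icc (0 : ℝ) t, gradient A (μ s) ≠ 0)
    (hflow : ∀ s ∈ Set.Icc (0 : ℝ) t,
      HasDerivAt μ (-(‖gradient A (μ s)‖⁻¹ • gradient A (μ s))) s)
    (hloj : ∀ s ∈ Set.Icc (0 : ℝ) t, |A (μ s)| ^ (1 - γ) ≤ C₀ * ‖gradient A (μ s)‖)
    (hhalf : ∀ s ∈ Set.Icc (0 : ℝ) t, A (μ s) ≥ (1 / 2) * A (μ 0))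
    (hpos : 0 < A (μ 0)) :
    A (μ t) - A (μ 0) ≤ -(2 : ℝ) ^ (γ - 1) * C₀⁻¹ * t * A (μ 0) ^ (1 - γ) := by
  have hder : ∀ s ∈ Set.Icc (0 : ℝ) t,
      HasDerivAt (fun s => A (μ s)) (-‖gradient A (μ s)‖) s := by
    intro s hs
    have hd : DifferentiableAt ℝ A (μ s) := (hA.differentiable one_ne_zero) (μ s)
    have h1 := hd.hasGradientAt.hasFDerivAt.comp_hasDerivAt s (hflow s hs)
    have hn : ‖gradient A (μ s)‖ ≠ 0 := norm_ne_zero_iff.mpr (hgrad s hs)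
    have h2 : (InnerProductSpace.toDual ℝ (EuclideanSpace ℝ (Fin ℓ)) (gradient A (μ s)))
        (-(‖gradient A (μ s)‖⁻¹ • gradient A (μ s))) = -‖gradient A (μ s)‖ := by
      rw [InnerProductSpace.toDual_apply_apply, inner_neg_right, inner_smul_right,
        real_inner_self_eq_norm_sq]
      field_simp
    rw [h2] at h1
    exact h1
  have hbound : ∀ s ∈ Set.Icc (0 : ℝ) t,
      -‖gradient A (μ s)‖ ≤ -((2 : ℝ) ^ (γ - 1) * C₀⁻¹ * A (μ 0) ^ (1 - γ)) := by
    intro s hs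
    have h1 : ((1 / 2) * A (μ 0)) ^ (1 - γ) ≤ |A (μ s)| ^ (1 - γ) :=
      Real.rpow_le_rpow (by positivity) ((hhalf s hs).le.trans (le_abs_self _))
        (by linarith [hγ.2])
    have h2 : ((1 / 2) * A (μ 0)) ^ (1 - γ) = (2 : ℝ) ^ (γ - 1) * A (μ 0) ^ (1 - γ) := by
      rw [Real.mul_rpow (by norm_num) hpos.le, one_div, Real.inv_rpow (by norm_num),
        ← Real.rpow_neg (by norm_num), neg_sub]
    have h3 := h1.trans (hloj s hs)
    rw [h2] at h3
    have h4 : C₀⁻¹ * ((2 : ℝ) ^ (γ - 1) * A (μ 0) ^ (1 - γ)) ≤ ‖gradient A (μ s)‖ := by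
      rw [inv_mul_le_iff₀ hC₀]
      exact h3
    linarith
  have key := (convex_Icc (0 : ℝ) t).image_sub_le_mul_sub_of_deriv_le
    (f := fun s => A (μ s))
    (C := -((2 : ℝ) ^ (γ - 1) * C₀⁻¹ * A (μ 0) ^ (1 - γ)))
    (fun s hs => (hder s hs).continuousAt.continuousWithinAt)
    (fun s hs => (hder s (interior_subset hs)).differentiableAt.differentiableWithinAt)
    (fun s hs => by
      rw [(hder s (interior_subset hs)).deriv]
      exact hbound s (interior_subset hs))
    0 ⟨le_rfl, ht.le⟩ t ⟨ht.le, le_rfl⟩ ht.le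
  linarith
end

section
/- Let E be a real inner product space, let θ ∈ E with ‖θ‖ = 1, let I ⊆ (0, ∞) be an open interval, and let g : I → E be differentiable with ⟨θ, g(r)⟩ = 0 for every r ∈ I. Define G(r) := r · (θ + g(r)) / √(1 + ‖g(r)‖²). Then for every r ∈ I one has ‖G'(r)‖ ≤ 1 + r² · ‖g'(r)‖². -/
open scoped RealInnerProductSpace

/-- radial derivative bound for a spherical graph, slicing lemma.
If `‖θ‖ = 1`, `g(r) ⟂ θ` and `G(r) = r (θ + g(r))/√(1 + ‖g(r)‖²)`, then
`‖G'(r)‖ ≤ 1 + r² ‖g'(r)‖²`. -/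
theorem norm_deriv_spherical_graph_le {E : Type*} [NormedAddCommGroup E]
    [InnerProductSpace ℝ E] (θ : E) (hθ : ‖θ‖ = 1) (a b : ℝ) (ha : 0 ≤ a)
    (g g' : ℝ → E)
    (hderiv : ∀ r ∈ Set.Ioo a b, HasDerivAt g (g' r) r)
    (horth : ∀ r ∈ Set.Ioo a b, ⟪θ, g r⟫ = 0) :
    ∀ r ∈ Set.Ioo a b,
      ‖deriv (fun r : ℝ => (r / Real.sqrt (1 + ‖g r‖ ^ 2)) • (θ + g r)) r‖ ≤
        1 + r ^ 2 * ‖g' r‖ ^ 2 := by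
  intro r hr
  have hg := hderiv r hr
  have hθg : ⟪θ, g' r⟫ = 0 := by
    have h1 : HasDerivAt (fun t => ⟪θ, g t⟫) (⟪θ, g' r⟫ + ⟪(0 : E), g r⟫) r :=
      (hasDerivAt_const r θ).inner ℝ hg
    have h2 : (fun t => ⟪θ, g t⟫) =ᶠ[nhds r] fun _ => (0 : ℝ) := by
      filter_upwards [Ioo_mem_nhds hr.1 hr.2] with t ht using horth t ht
    have h3 := (h1.congr_of_eventuallyEq h2.symm).unique (hasDerivAt_const r (0 : ℝ))
    simpa using h3
  have hS : 0 < 1 + ‖g r‖ ^ 2 := by positivity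
  obtain ⟨s, hs⟩ : ∃ s, s = Real.sqrt (1 + ‖g r‖ ^ 2) := ⟨_, rfl⟩
  have hs0 : 0 < s := hs ▸ Real.sqrt_pos.2 hS
  have hss : s ^ 2 = 1 + ‖g r‖ ^ 2 := by rw [hs]; exact Real.sq_sqrt hS.le
  have hd1 := ((hg.norm_sq).const_add 1).sqrt hS.ne'
  have hd2 := ((hasDerivAt_id r).div hd1 (by rw [← hs]; exact hs0.ne')).smul (hg.const_add θ)
  have hd3 := hd2.deriv
  simp only [id, Pi.div_apply, ← hs] at hd3
  obtain ⟨p, hp⟩ : ∃ p, p = ⟪g r, g' r⟫ := ⟨_, rfl⟩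
  have key : deriv (fun r : ℝ => (r / Real.sqrt (1 + ‖g r‖ ^ 2)) • (θ + g r)) r
      = (1 / s - r * p / s ^ 3) • (θ + g r) + (r / s) • g' r := by
    refine Eq.trans hd3 ?_
    rw [add_comm, ← hp]
    congr 2
    field_simp
  have hww : ⟪θ + g r, θ + g r⟫ = s ^ 2 := by
    rw [real_inner_self_eq_norm_sq, norm_add_sq_real, horth r hr, hθ, hss]; ring
  have hwg : ⟪θ + g r, g' r⟫ = p := by rw [inner_add_left, hθg, hp, zero_add]
  have hsq : ‖(1 / s - r * p / s ^ 3) • (θ + g r) + (r / s) • g' r‖ ^ 2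
      = 1 + r ^ 2 * ‖g' r‖ ^ 2 / s ^ 2 - (r * p / s ^ 2) ^ 2 := by
    rw [norm_add_sq_real, inner_smul_left, inner_smul_right, hwg, norm_smul, norm_smul,
      mul_pow, mul_pow, ← real_inner_self_eq_norm_sq (θ + g r), hww]
    simp only [Real.norm_eq_abs, sq_abs, conj_trivial]
    field_simp
    ring
  rw [key]
  have hx : 0 ≤ r ^ 2 * ‖g' r‖ ^ 2 := by positivity
  have hle : r ^ 2 * ‖g' r‖ ^ 2 / s ^ 2 ≤ r ^ 2 * ‖g' r‖ ^ 2 :=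
    div_le_self hx (by rw [hss]; nlinarith [sq_nonneg ‖g r‖])
  refine (sq_le_sq₀ (norm_nonneg _) (by positivity)).1 ?_
  rw [hsq]
  nlinarith [sq_nonneg (r * p / s ^ 2)]
end

section
/- Let ℓ ≥ 1 and let A : ℝ^ℓ → ℝ be real-analytic in a neighborhood of the origin. Let p ≥ 2 be such that the iterated Fréchet derivatives D^j A(0) vanish for all 1 ≤ j < p, and define the degree-p homogeneous polynomial A_p(x) := (1/p!) · D^p A(0)[x, …, x]. Suppose there exist s₀ > 0, a map Ψ : (0, s₀) → ℝ^ℓ and a vector φ ∈ ℝ^ℓ such that ∇A(Ψ(s)) = 0 for every s ∈ (0, s₀) and Ψ(s)/s → φ as s → 0⁺. Then ∇A_p(φ) = 0. -/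
open Filter Topology Asymptotics

theorem aux_fderiv_bigO {E : Type*} [NormedAddCommGroup E] [NormedSpace ℝ E]
    (A : E → ℝ) (hA : AnalyticAt ℝ A 0) (p : ℕ) (hp : 2 ≤ p)
    (hvanish : ∀ j : ℕ, 1 ≤ j → j < p → iteratedFDeriv ℝ j A 0 = 0) :
    (fderiv ℝ (fun x => A x - A 0 -
      ((p.factorial : ℝ))⁻¹ * iteratedFDeriv ℝ p A 0 (fun _ => x)))
      =O[𝓝 0] fun y => ‖y‖ ^ p := by
  obtain ⟨q, r, hq⟩ := hA
  have hdiag : ∀ n y, q n (fun _ => y)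
      = ((n.factorial : ℝ))⁻¹ * iteratedFDeriv ℝ n A 0 (fun _ => y) := by
    intro n y
    rw [← hq.factorial_smul y n, nsmul_eq_mul, inv_mul_cancel_left₀]
    exact_mod_cast n.factorial_ne_zero
  let t : FormalMultilinearSeries ℝ E ℝ := fun n => if n ≤ p then 0 else q n
  have htn : ∀ n, ‖t n‖ ≤ ‖q n‖ := by
    intro n
    by_cases h : n ≤ p <;> simp [t, h]
  have ht : HasFPowerSeriesOnBall (fun x => A x - A 0 -
      ((p.factorial : ℝ))⁻¹ * iteratedFDeriv ℝ p A 0 (fun _ => x)) t 0 r := by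
    refine ⟨?_, hq.r_pos, ?_⟩
    · refine hq.r_le.trans (ENNReal.le_of_forall_nnreal_lt fun ρ hρ => ?_)
      obtain ⟨C, -, hC⟩ := q.norm_mul_pow_le_of_lt_radius hρ
      refine t.le_radius_of_bound C fun n => le_trans ?_ (hC n)
      gcongr
      exact htn n
    · intro y hy
      have h1 := hq.hasSum hy
      have h2 := hasSum_ite_eq (0 : ℕ) (A 0)
      have h3 := hasSum_ite_eq p
        (((p.factorial : ℝ))⁻¹ * iteratedFDeriv ℝ p A 0 (fun _ => y))
      have h := (h1.sub h2).sub h3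
      simp only [zero_add] at h ⊢
      convert h using 2 with n
      rcases Nat.eq_zero_or_pos n with rfl | hn
      · have : 0 ≠ p := by omega
        have h0 := hdiag 0 y
        simp [t, this, h0]
      · rcases lt_trichotomy n p with h | h | h
        · have := hdiag n y
          rw [hvanish n hn h] at this
          simp [t, h.le, h.ne, hn.ne', this]
        · subst h
          simp [t, hn.ne', hdiag]
        · simp [t, h.not_ge, h.ne', hn.ne']
  have hb := ht.fderiv.hasFPowerSeriesAt.isBigO_sub_partialSum_pow p
  refine hb.congr_left fun y => ?_
  rw [zero_add, FormalMultilinearSeries.partialSum, Finset.sum_eq_zero, sub_zero]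
  intro k hk
  have hk' : 1 + k ≤ p := by simp at hk; omega
  have : t.derivSeries k = 0 := by
    have h0 : t (1 + k) = 0 := by simp [t, hk']
    have : t.changeOriginSeries 1 k = 0 := by
      rw [FormalMultilinearSeries.changeOriginSeries]
      refine Finset.sum_eq_zero fun s _ => ?_
      rw [FormalMultilinearSeries.changeOriginSeriesTerm, h0]
      exact LinearIsometryEquiv.map_zero _
    ext
    simp [FormalMultilinearSeries.derivSeries, this]
  simp [this]

/-- a curve of critical points kills the gradient of the lowest-order
homogeneous part. If `A` is real-analytic near `0`, its derivatives of orders `1 ≤ j < p`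
vanish at `0`, `A_p(x) = (1/p!) DᵖA(0)[x, …, x]`, and `Ψ(s)` is a curve of critical points
of `A` with `Ψ(s)/s → φ` as `s → 0⁺`, then `∇A_p(φ) = 0`. -/
theorem gradient_homogeneous_part_eq_zero (ℓ : ℕ) (hℓ : 1 ≤ ℓ)
    (A : EuclideanSpace ℝ (Fin ℓ) → ℝ) (hA : AnalyticAt ℝ A 0) (p : ℕ) (hp : 2 ≤ p)
    (hvanish : ∀ j : ℕ, 1 ≤ j → j < p → iteratedFDeriv ℝ j A 0 = 0)
    (s₀ : ℝ) (hs₀ : 0 < s₀) (Ψ : ℝ → EuclideanSpace ℝ (Fin ℓ))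
    (φ : EuclideanSpace ℝ (Fin ℓ))
    (hcrit : ∀ s ∈ Set.Ioo (0 : ℝ) s₀, gradient A (Ψ s) = 0)
    (hlim : Filter.Tendsto (fun s : ℝ => s⁻¹ • Ψ s)
      (nhdsWithin 0 (Set.Ioi 0)) (nhds φ)) :
    gradient (fun x => ((p.factorial : ℝ))⁻¹ * iteratedFDeriv ℝ p A 0 (fun _ => x)) φ = 0 := by
  have hO := aux_fderiv_bigO A hA p hp hvanish
  set B : EuclideanSpace ℝ (Fin ℓ) → ℝ :=
    fun x => ((p.factorial : ℝ))⁻¹ * iteratedFDeriv ℝ p A 0 (fun _ => x) with hB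
  have hBc : ContDiff ℝ 1 B := by
    refine contDiff_const.mul ?_
    exact (iteratedFDeriv ℝ p A 0).contDiff.comp (contDiff_pi.2 fun _ => contDiff_id)
  have hBd : Differentiable ℝ B := hBc.differentiable (by norm_num)
  have hBhom : ∀ (c : ℝ) x, B (c • x) = c ^ p * B x := by
    intro c x
    have := (iteratedFDeriv ℝ p A 0).map_smul_univ (fun _ => c) (fun _ => x)
    simp only [Finset.prod_const, Finset.card_univ, Fintype.card_fin, smul_eq_mul] at this
    simp only [hB, this]
    ring
  have hfhom : ∀ c : ℝ, c ≠ 0 → ∀ x, fderiv ℝ B (c • x) = c ^ (p - 1) • fderiv ℝ B x := by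
    intro c hc x
    have h1 := fderiv_comp_smul (𝕜 := ℝ) (f := B) (x := x) c
    have h2 : (fun y => B (c • y)) = fun y => c ^ p • B y := by
      funext y; simp [hBhom]
    rw [h2, fderiv_fun_const_smul (hBd x)] at h1
    have hpp : c ^ p = c * c ^ (p - 1) := by
      rw [← pow_succ']; congr 1; omega
    rw [hpp, mul_smul] at h1
    exact (smul_right_injective _ hc h1).symm
  have hid : Tendsto (fun s : ℝ => s) (𝓝[>] 0) (𝓝 0) := tendsto_nhdsWithin_of_tendsto_nhds tendsto_id
  have hpos : ∀ᶠ s : ℝ in 𝓝[>] 0, s ∈ Set.Ioo (0 : ℝ) s₀ := Ioo_mem_nhdsGT hs₀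
  have hΨ : Tendsto Ψ (𝓝[>] 0) (𝓝 0) := by
    have h := hid.smul hlim
    rw [zero_smul] at h
    refine h.congr' ?_
    filter_upwards [hpos] with s hs
    rw [smul_inv_smul₀ hs.1.ne']
  have hAd : ∀ᶠ y in 𝓝 (0 : EuclideanSpace ℝ (Fin ℓ)), DifferentiableAt ℝ A y :=
    hA.eventually_analyticAt.mono fun y hy => hy.differentiableAt
  obtain ⟨C, hC⟩ := hO.bound
  have hlimB : Tendsto (fun s : ℝ => fderiv ℝ B (s⁻¹ • Ψ s)) (𝓝[>] 0) (𝓝 (fderiv ℝ B φ)) :=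
    ((hBc.continuous_fderiv (by norm_num)).tendsto φ).comp hlim
  have hlim0 : Tendsto (fun s : ℝ => fderiv ℝ B (s⁻¹ • Ψ s)) (𝓝[>] 0) (𝓝 0) := by
    have hg : Tendsto (fun s : ℝ => s * (C * ‖s⁻¹ • Ψ s‖ ^ p)) (𝓝[>] 0) (𝓝 0) := by
      simpa using hid.mul ((hlim.norm.pow p).const_mul C)
    refine squeeze_zero_norm' ?_ hg
    filter_upwards [hpos, hΨ.eventually hC, hΨ.eventually hAd] with s hs hCs hds
    have hA0 : fderiv ℝ A (Ψ s) = 0 := by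
      have := hcrit s hs
      simpa [gradient] using this
    have hR : fderiv ℝ (fun x => A x - A 0 - B x) (Ψ s) = - fderiv ℝ B (Ψ s) := by
      rw [fderiv_fun_sub (hds.sub_const _) (hBd _), fderiv_sub_const, hA0, zero_sub]
    rw [hR, norm_neg, norm_pow, norm_norm] at hCs
    have hs0 : 0 < s := hs.1
    rw [hfhom _ (inv_ne_zero hs0.ne'), norm_smul, norm_smul, norm_pow, norm_inv,
      Real.norm_of_nonneg hs0.le]
    calc _ ≤ s⁻¹ ^ (p - 1) * (C * ‖Ψ s‖ ^ p) := by gcongr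
      _ = _ := by
        obtain ⟨m, rfl⟩ : ∃ m, p = m + 1 := ⟨p - 1, by omega⟩
        simp only [Nat.add_sub_cancel]
        rw [mul_pow, inv_pow, inv_pow, pow_succ s]
        field_simp
  have h0 : fderiv ℝ B φ = 0 := tendsto_nhds_unique hlimB hlim0
  simp [gradient, h0]
end

section
/- Let ℓ ≥ 1 and let A : ℝ^ℓ → ℝ be real-analytic in a neighborhood of the origin with ∇A(0) = 0. Suppose that for every vector v ∈ ℝ^ℓ there exist s₀ > 0 and a map Ψ : [0, s₀) → ℝ^ℓ with Ψ(0) = 0, ∇A(Ψ(s)) = 0 for every s ∈ [0, s₀), and Ψ(s)/s → v as s → 0⁺. Then A is constant in a neighborhood of the origin. -/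
open Filter Topology Asymptotics in
/-- An analytic map vanishing along curves with every initial velocity vanishes near `0`. -/
lemma eventually_zero_of_curves {E F : Type*} [NormedAddCommGroup E] [NormedSpace ℝ E]
    [NormedAddCommGroup F] [NormedSpace ℝ F] (G : E → F) (hG : AnalyticAt ℝ G 0)
    (hint : ∀ v : E, ∃ Ψ : ℝ → E, (∀ᶠ s in 𝓝[>] (0 : ℝ), G (Ψ s) = 0) ∧
        Tendsto (fun s : ℝ => s⁻¹ • Ψ s) (𝓝[>] 0) (𝓝 v)) :
    ∀ᶠ x in 𝓝 (0 : E), G x = 0 := by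
  obtain ⟨q, hq⟩ := hG
  have key : ∀ n : ℕ, ∀ v : E, q n (fun _ => v) = 0 := by
    intro n
    induction n using Nat.strong_induction_on with
    | _ n ih =>
    intro v
    obtain ⟨Ψ, hΨ, hlim⟩ := hint v
    have hid : Tendsto (fun s : ℝ => s) (𝓝[>] 0) (𝓝 0) := tendsto_nhdsWithin_of_tendsto_nhds tendsto_id
    have hpos : ∀ᶠ s in 𝓝[>] (0 : ℝ), 0 < s := eventually_mem_nhdsWithin
    have hΨ0 : Tendsto Ψ (𝓝[>] 0) (𝓝 0) := by
      have h := hid.smul hlim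
      rw [zero_smul] at h
      refine h.congr' ?_
      filter_upwards [hpos] with s hs
      rw [smul_smul, mul_inv_cancel₀ hs.ne', one_smul]
    have hO := (hq.isBigO_sub_partialSum_pow (n + 1)).comp_tendsto hΨ0
    obtain ⟨C, hC⟩ := hO.bound
    have hbound : ∀ᶠ s in 𝓝[>] (0 : ℝ),
        ‖q n (fun _ => s⁻¹ • Ψ s)‖ ≤ C * (s * ‖s⁻¹ • Ψ s‖ ^ (n + 1)) := by
      filter_upwards [hC, hΨ, hpos] with s h1 h2 hs
      have hps : q.partialSum (n + 1) (Ψ s) = q n (fun _ => Ψ s) := by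
        rw [FormalMultilinearSeries.partialSum, Finset.sum_range_succ, Finset.sum_eq_zero, zero_add]
        intro i hi
        exact ih i (Finset.mem_range.1 hi) _
      simp only [Function.comp, zero_add, h2, hps, zero_sub, norm_neg, norm_pow, norm_norm] at h1
      rw [ContinuousMultilinearMap.map_smul_univ]
      simp only [Finset.prod_const, Finset.card_univ, Fintype.card_fin, norm_smul, norm_pow,
        norm_inv, Real.norm_of_nonneg hs.le]
      calc s⁻¹ ^ n * ‖q n (fun _ => Ψ s)‖ ≤ s⁻¹ ^ n * (C * ‖Ψ s‖ ^ (n + 1)) := by gcongr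
        _ = C * (s * (s⁻¹ * ‖Ψ s‖) ^ (n + 1)) := by
          rw [mul_pow, pow_succ s⁻¹]
          field_simp
    have hL : Tendsto (fun s : ℝ => ‖q n (fun _ => s⁻¹ • Ψ s)‖) (𝓝[>] 0)
        (𝓝 ‖q n (fun _ => v)‖) :=
      (((q n).cont.tendsto _).comp (tendsto_pi_nhds.2 fun _ => hlim)).norm
    have hR : Tendsto (fun s : ℝ => C * (s * ‖s⁻¹ • Ψ s‖ ^ (n + 1))) (𝓝[>] 0) (𝓝 0) := by
      have := (hid.mul (hlim.norm.pow (n + 1))).const_mul C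
      simpa using this
    exact norm_le_zero_iff.1 (le_of_tendsto_of_tendsto hL hR hbound)
  filter_upwards [hq.eventually_hasSum] with y hy
  simp only [key, zero_add] at hy
  exact hy.unique hasSum_zero


/-- integrability forces the reduced functional to be constant.
If `A` is real-analytic near `0` with `∇A(0) = 0`, and every direction `v` is the initial
velocity of a curve of critical points of `A` emanating from the origin, then `A` is
constant in a neighborhood of the origin. -/
theorem constant_of_integrability (ℓ : ℕ) (hℓ : 1 ≤ ℓ)
    (A : EuclideanSpace ℝ (Fin ℓ) → ℝ) (hA : AnalyticAt ℝ A 0)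
    (hgrad0 : gradient A 0 = 0)
    (hint : ∀ v : EuclideanSpace ℝ (Fin ℓ), ∃ s₀ : ℝ, 0 < s₀ ∧
      ∃ Ψ : ℝ → EuclideanSpace ℝ (Fin ℓ), Ψ 0 = 0 ∧
        (∀ s ∈ Set.Ico (0 : ℝ) s₀, gradient A (Ψ s) = 0) ∧
        Filter.Tendsto (fun s : ℝ => s⁻¹ • Ψ s) (nhdsWithin 0 (Set.Ioi 0)) (nhds v)) :
    ∀ᶠ x in nhds (0 : EuclideanSpace ℝ (Fin ℓ)), A x = A 0 := by
  have hz : ∀ᶠ x in nhds (0 : EuclideanSpace ℝ (Fin ℓ)), fderiv ℝ A x = 0 := by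
    refine eventually_zero_of_curves _ hA.fderiv fun v => ?_
    obtain ⟨s₀, hs₀, Ψ, -, hΨ, hlim⟩ := hint v
    refine ⟨Ψ, ?_, hlim⟩
    filter_upwards [Ioo_mem_nhdsGT hs₀] with s hs
    have h := hΨ s ⟨hs.1.le, hs.2⟩
    simpa [gradient] using h
  obtain ⟨r, hr, hball⟩ := Metric.eventually_nhds_iff_ball.1 (hz.and hA.eventually_analyticAt)
  filter_upwards [Metric.ball_mem_nhds _ hr] with x hx
  exact Metric.isOpen_ball.is_const_of_fderiv_eq_zero
    (convex_ball _ _).isPreconnected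
    (fun y hy => (hball y hy).2.differentiableAt.differentiableWithinAt)
    (fun y hy => (hball y hy).1) hx (Metric.mem_ball_self hr)
end
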